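/- arXiv:2402.13719 — 14 statements merged into one kernel-verified Lean document; each statement's English description precedes it below -/
import Mathlib

section
/- Assume in addition that there are constants c_j ∈ (0,1] with ν_j(μ) ≥ c_j for all μ ∈ ℝ^m and all j. Then the vector μ^(0) defined by μ_j^(0) = min{0, p_j^{−1}(c_j · α)} is a valid starting value, i.e., it satisfies p_j(μ_j^(0)) · q^{−max(μ_j^(0),0)} ≤ ν_j(μ^(0)) · α for all j = 1,…,m. -/
open Filter Topology

/-- If the weight functions `ν j` are bounded below by constants `c j ∈ (0,1]`, then the
vector `μ⁰` with `μ⁰ j = min 0 (p j)⁻¹(c j * α)` is a valid starting value for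
Algorithm 1, i.e. `p j (μ⁰ j) * q ^ (-(max (μ⁰ j) 0)) ≤ ν j μ⁰ * α` for all `j`. -/
theorem stmt1 (m : ℕ) (hm : 1 ≤ m)
    (q α : ℝ) (hq : q ∈ Set.Ioo (0 : ℝ) 1) (hα : α ∈ Set.Ioo (0 : ℝ) 1)
    (p : Fin m → ℝ → ℝ)
    (hp_cont : ∀ j, Continuous (p j))
    (hp_mono : ∀ j, StrictMono (p j))
    (hp_range : ∀ j t, p j t ∈ Set.Ioo (0 : ℝ) 1)
    (hp_bot : ∀ j, Tendsto (p j) atBot (nhds 0))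
    (hp_top : ∀ j, Tendsto (p j) atTop (nhds 1))
    (ν : Fin m → (Fin m → ℝ) → ℝ)
    (hν_cont : ∀ j, Continuous (ν j))
    (hν_mono : ∀ j, Monotone (ν j))
    (hν_nonneg : ∀ j μ, 0 ≤ ν j μ)
    (c : Fin m → ℝ) (hc : ∀ j, c j ∈ Set.Ioc (0 : ℝ) 1)
    (hνc : ∀ j μ, c j ≤ ν j μ)
    -- `t j` is the value `(p j)⁻¹ (c j * α)` of the inverse p-value function
    (t : Fin m → ℝ) (ht : ∀ j, p j (t j) = c j * α)
    (μ0 : Fin m → ℝ) (hμ0 : ∀ j, μ0 j = min 0 (t j)) :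
    ∀ j, p j (μ0 j) * q ^ (-(max (μ0 j) 0)) ≤ ν j μ0 * α := by
  intro j
  have h0 : μ0 j ≤ 0 := hμ0 j ▸ min_le_left _ _
  have ht0 : μ0 j ≤ t j := hμ0 j ▸ min_le_right _ _
  rw [max_eq_right h0, neg_zero, Real.rpow_zero, mul_one]
  calc p j (μ0 j) ≤ p j (t j) := (hp_mono j).monotone ht0
    _ = c j * α := ht j
    _ ≤ ν j μ0 * α := mul_le_mul_of_nonneg_right (hνc j μ0) hα.1.le
end

section
/- Let μ^(0) be a valid starting value and let (μ^(k))_{k≥0} be the iterates of Algorithm 1. Then the sequence is componentwise non-decreasing, i.e., μ_j^(k+1) ≥ μ_j^(k) for all k ≥ 0 and all j, and every iterate is itself a valid starting value, i.e., p_j(μ_j^(k)) · q^{−max(μ_j^(k),0)} ≤ ν_j(μ^(k)) · α for all k ≥ 0 and all j. -/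
open Filter Topology

/-- Multiplying a positive strictly increasing function by `q ^ (-max t 0)` with `0 < q < 1`
preserves strict monotonicity. -/
theorem strictMono_mul_rpow_neg_max {q : ℝ} (hq : q ∈ Set.Ioo (0 : ℝ) 1) {f : ℝ → ℝ}
    (hf : StrictMono f) (hf_pos : ∀ t, 0 < f t) :
    StrictMono fun t => f t * q ^ (-(max t 0)) := fun _ t hst =>
  mul_lt_mul (hf hst)
    (Real.rpow_le_rpow_of_exponent_ge hq.1 hq.2.le (neg_le_neg (max_le_max_right 0 hst.le)))
    (Real.rpow_pos_of_pos hq.1 _) (hf_pos t).le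

/-- The iterates of Algorithm 1 are componentwise non-decreasing, and every iterate is
itself a valid starting value. -/
theorem stmt2 (m : ℕ) (hm : 1 ≤ m)
    (q α : ℝ) (hq : q ∈ Set.Ioo (0 : ℝ) 1) (hα : α ∈ Set.Ioo (0 : ℝ) 1)
    (p : Fin m → ℝ → ℝ)
    (hp_cont : ∀ j, Continuous (p j))
    (hp_mono : ∀ j, StrictMono (p j))
    (hp_range : ∀ j t, p j t ∈ Set.Ioo (0 : ℝ) 1)
    (hp_bot : ∀ j, Tendsto (p j) atBot (nhds 0))
    (hp_top : ∀ j, Tendsto (p j) atTop (nhds 1))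
    (ν : Fin m → (Fin m → ℝ) → ℝ)
    (hν_cont : ∀ j, Continuous (ν j))
    (hν_mono : ∀ j, Monotone (ν j))
    (hν_pos : ∀ j μ, 0 < ν j μ)
    (hw_sum : ∀ μ : Fin m → ℝ, ∑ j, q ^ max (μ j) 0 * ν j μ = 1)
    (μ : ℕ → Fin m → ℝ)
    (hstart : ∀ j, p j (μ 0 j) * q ^ (-(max (μ 0 j) 0)) ≤ ν j (μ 0) * α)
    (hstep : ∀ k j, p j (μ (k + 1) j) * q ^ (-(max (μ (k + 1) j) 0)) = ν j (μ k) * α) :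
    (∀ k j, μ k j ≤ μ (k + 1) j)
    ∧ (∀ k j, p j (μ k j) * q ^ (-(max (μ k j) 0)) ≤ ν j (μ k) * α) := by
  have valid : ∀ k j, p j (μ k j) * q ^ (-(max (μ k j) 0)) ≤ ν j (μ k) * α := by
    intro k
    induction k with
    | zero => exact hstart
    | succ k ih =>
      intro j
      rw [hstep k j]
      have hle : μ k ≤ μ (k + 1) := fun i =>
        (strictMono_mul_rpow_neg_max hq (hp_mono i) fun t => (hp_range i t).1).le_iff_le.mp
          ((ih i).trans_eq (hstep k i).symm)
      exact mul_le_mul_of_nonneg_right (hν_mono j hle) hα.1.le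
  exact ⟨fun k j =>
    (strictMono_mul_rpow_neg_max hq (hp_mono j) fun t => (hp_range j t).1).le_iff_le.mp
      ((valid k j).trans_eq (hstep k j).symm), valid⟩
end

section
/- Let μ^(0) be a valid starting value and let μ^∞ ∈ ℝ^m be the limit of the iterates of Algorithm 1. Then μ^∞ satisfies the fixed-point equations p_j(μ_j^∞) · q^{−max(μ_j^∞,0)} = ν_j(μ^∞) · α for all j = 1,…,m; equivalently, p_j(μ_j^∞) = α · w_j(μ^∞) for all j. -/
open Filter Topology

/-- The limit `μ^∞` of the iterates of Algorithm 1 satisfies the fixed-point equations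
`p j (μ^∞ j) * q ^ (-(max (μ^∞ j) 0)) = ν j μ^∞ * α`, equivalently
`p j (μ^∞ j) = α * w j μ^∞`, for all `j`. -/
theorem stmt4 (m : ℕ) (hm : 1 ≤ m)
    (q α : ℝ) (hq : q ∈ Set.Ioo (0 : ℝ) 1) (hα : α ∈ Set.Ioo (0 : ℝ) 1)
    (p : Fin m → ℝ → ℝ)
    (hp_cont : ∀ j, Continuous (p j))
    (hp_mono : ∀ j, StrictMono (p j))
    (hp_range : ∀ j t, p j t ∈ Set.Ioo (0 : ℝ) 1)
    (hp_bot : ∀ j, Tendsto (p j) atBot (nhds 0))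
    (hp_top : ∀ j, Tendsto (p j) atTop (nhds 1))
    (ν : Fin m → (Fin m → ℝ) → ℝ)
    (hν_cont : ∀ j, Continuous (ν j))
    (hν_mono : ∀ j, Monotone (ν j))
    (hν_pos : ∀ j μ, 0 < ν j μ)
    (hw_sum : ∀ μ : Fin m → ℝ, ∑ j, q ^ max (μ j) 0 * ν j μ = 1)
    (μ : ℕ → Fin m → ℝ)
    (hstart : ∀ j, p j (μ 0 j) * q ^ (-(max (μ 0 j) 0)) ≤ ν j (μ 0) * α)
    (hstep : ∀ k j, p j (μ (k + 1) j) * q ^ (-(max (μ (k + 1) j) 0)) = ν j (μ k) * α)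
    (μinf : Fin m → ℝ)
    (hlim : ∀ j, Tendsto (fun k => μ k j) atTop (nhds (μinf j))) :
    ∀ j, p j (μinf j) * q ^ (-(max (μinf j) 0)) = ν j μinf * α
      ∧ p j (μinf j) = α * (q ^ max (μinf j) 0 * ν j μinf) := by
  have hq0 : 0 < q := hq.1
  have hμ : Tendsto μ atTop (𝓝 μinf) := tendsto_pi_nhds.2 hlim
  intro j
  have hcont : Continuous fun t => p j t * q ^ (-(max t 0)) :=
    (hp_cont j).mul <|
      continuous_const.rpow (by fun_prop) fun _ => Or.inl hq0.ne'
  have hleft : Tendsto (fun k => p j (μ (k + 1) j) * q ^ (-(max (μ (k + 1) j) 0))) atTop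
      (𝓝 (p j (μinf j) * q ^ (-(max (μinf j) 0)))) :=
    (hcont.tendsto (μinf j)).comp ((hlim j).comp (tendsto_add_atTop_nat 1))
  have hright : Tendsto (fun k => ν j (μ k) * α) atTop (𝓝 (ν j μinf * α)) :=
    (((hν_cont j).tendsto μinf).comp hμ).mul_const α
  have hfix : p j (μinf j) * q ^ (-(max (μinf j) 0)) = ν j μinf * α :=
    tendsto_nhds_unique hleft (hright.congr fun k => (hstep k j).symm)
  refine ⟨hfix, ?_⟩
  rw [Real.rpow_neg hq0.le, ← div_eq_mul_inv, div_eq_iff (Real.rpow_pos_of_pos hq0 _).ne'] at hfix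
  rw [hfix]
  ring
end

section
/- Let μ^(0) be a valid starting value and let μ^∞ ∈ ℝ^m be the limit of the iterates of Algorithm 1. Then μ^∞ ∈ M, and the adjusted p-value of the limit equals the significance level: p(μ^∞) = α. -/
open Filter Topology

/-- The adjusted p-value `p(μ) = min { p j (μ j) / w j μ : w j μ > 0 }`, where
`w j μ = q ^ max (μ j) 0 * ν j μ`. -/
noncomputable def padj (q : ℝ) {m : ℕ} (p : Fin m → ℝ → ℝ)
    (ν : Fin m → (Fin m → ℝ) → ℝ) (μ : Fin m → ℝ) : ℝ :=
  sInf {x : ℝ | ∃ j : Fin m,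
    0 < q ^ max (μ j) 0 * ν j μ ∧ x = p j (μ j) / (q ^ max (μ j) 0 * ν j μ)}

/-- The limit `μ^∞` of the iterates of Algorithm 1 lies in the set
`M = {μ : ∃ u ∈ (0,1), p j (μ j) = u * w j μ for all j}`, and its adjusted p-value
equals the significance level: `p(μ^∞) = α`. -/
theorem stmt5 (m : ℕ) (hm : 1 ≤ m)
    (q α : ℝ) (hq : q ∈ Set.Ioo (0 : ℝ) 1) (hα : α ∈ Set.Ioo (0 : ℝ) 1)
    (p : Fin m → ℝ → ℝ)
    (hp_cont : ∀ j, Continuous (p j))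
    (hp_mono : ∀ j, StrictMono (p j))
    (hp_range : ∀ j t, p j t ∈ Set.Ioo (0 : ℝ) 1)
    (hp_bot : ∀ j, Tendsto (p j) atBot (nhds 0))
    (hp_top : ∀ j, Tendsto (p j) atTop (nhds 1))
    (ν : Fin m → (Fin m → ℝ) → ℝ)
    (hν_cont : ∀ j, Continuous (ν j))
    (hν_mono : ∀ j, Monotone (ν j))
    (hν_pos : ∀ j μ, 0 < ν j μ)
    (hw_sum : ∀ μ : Fin m → ℝ, ∑ j, q ^ max (μ j) 0 * ν j μ = 1)
    (μ : ℕ → Fin m → ℝ)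
    (hstart : ∀ j, p j (μ 0 j) * q ^ (-(max (μ 0 j) 0)) ≤ ν j (μ 0) * α)
    (hstep : ∀ k j, p j (μ (k + 1) j) * q ^ (-(max (μ (k + 1) j) 0)) = ν j (μ k) * α)
    (μinf : Fin m → ℝ)
    (hlim : ∀ j, Tendsto (fun k => μ k j) atTop (nhds (μinf j))) :
    (∃ u ∈ Set.Ioo (0 : ℝ) 1,
        ∀ j, p j (μinf j) = u * (q ^ max (μinf j) 0 * ν j μinf))
    ∧ padj q p ν μinf = α := by
  obtain ⟨hq0, -⟩ := hq
  have hfix : ∀ j, p j (μinf j) * q ^ (-(max (μinf j) 0)) = ν j μinf * α := by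
    intro j
    have hlhs : Tendsto (fun k => p j (μ (k + 1) j) * q ^ (-(max (μ (k + 1) j) 0))) atTop
        (𝓝 (p j (μinf j) * q ^ (-(max (μinf j) 0)))) := by
      have hcont : Continuous fun t : ℝ => p j t * q ^ (-(max t 0)) :=
        (hp_cont j).mul
          (continuous_const.rpow (by fun_prop) fun _ => Or.inl hq0.ne')
      exact (hcont.tendsto _).comp ((hlim j).comp (tendsto_add_atTop_nat 1))
    have hrhs : Tendsto (fun k => ν j (μ k) * α) atTop (𝓝 (ν j μinf * α)) :=
      (((hν_cont j).tendsto _).comp (tendsto_pi_nhds.2 hlim)).mul_const α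
    simp only [hstep] at hlhs
    exact tendsto_nhds_unique hlhs hrhs
  have hw_pos : ∀ j, 0 < q ^ max (μinf j) 0 * ν j μinf := fun j =>
    mul_pos (Real.rpow_pos_of_pos hq0 _) (hν_pos j _)
  have hprop : ∀ j, p j (μinf j) = α * (q ^ max (μinf j) 0 * ν j μinf) := by
    intro j
    have hpow : 0 < q ^ max (μinf j) 0 := Real.rpow_pos_of_pos hq0 _
    have h := hfix j
    rw [Real.rpow_neg hq0.le, ← div_eq_mul_inv, div_eq_iff hpow.ne'] at h
    rw [h]
    ring
  refine ⟨⟨α, hα, hprop⟩, ?_⟩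
  have hset : {x : ℝ | ∃ j : Fin m, 0 < q ^ max (μinf j) 0 * ν j μinf ∧
      x = p j (μinf j) / (q ^ max (μinf j) 0 * ν j μinf)} = {α} := by
    have hratio : ∀ j, p j (μinf j) / (q ^ max (μinf j) 0 * ν j μinf) = α := fun j =>
      (div_eq_iff (hw_pos j).ne').2 (hprop j)
    ext x
    simp only [Set.mem_ofPred_eq, hratio, Set.mem_singleton_iff]
    exact ⟨fun ⟨_, _, hx⟩ => hx, fun hx => ⟨⟨0, hm⟩, hw_pos _, hx⟩⟩
  rw [padj, hset, csInf_singleton]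
end

section
/- There is at most one fixed point at level α: if μ, μ′ ∈ ℝ^m satisfy p_j(μ_j) = α · w_j(μ) for all j and p_j(μ′_j) = α · w_j(μ′) for all j, then μ = μ′. -/
open Filter Topology

/-- Subsolutions are closed under coordinatewise maxima, and the total weight is constant,
so a fixed point dominates every other fixed point. -/
theorem fixedPoint_le_of_fixedPoint {ι : Type*} [Fintype ι] {q α : ℝ} (hq : 0 < q) (hα : 0 < α)
    {p : ι → ℝ → ℝ} (hp : ∀ j, StrictMono (p j))
    {ν : ι → (ι → ℝ) → ℝ} (hν : ∀ j, Monotone (ν j))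
    (hw : ∀ μ : ι → ℝ, ∑ j, q ^ max (μ j) 0 * ν j μ = 1)
    {μ μ' : ι → ℝ}
    (hμ : ∀ j, p j (μ j) = α * (q ^ max (μ j) 0 * ν j μ))
    (hμ' : ∀ j, p j (μ' j) = α * (q ^ max (μ' j) 0 * ν j μ')) :
    μ' ≤ μ := by
  have hsub : ∀ j, p j ((μ ⊔ μ') j) ≤
      α * (q ^ max ((μ ⊔ μ') j) 0 * ν j (μ ⊔ μ')) := by
    intro j
    rcases le_total (μ' j) (μ j) with h | h
    · rw [Pi.sup_apply, sup_eq_left.mpr h, hμ j]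
      have hle := hν j (le_sup_left : μ ≤ μ ⊔ μ')
      gcongr
    · rw [Pi.sup_apply, sup_eq_right.mpr h, hμ' j]
      have hle := hν j (le_sup_right : μ' ≤ μ ⊔ μ')
      gcongr
  have hsum_sup : ∑ j, p j ((μ ⊔ μ') j) ≤ α := by
    refine (Finset.sum_le_sum fun j _ => hsub j).trans_eq ?_
    rw [← Finset.mul_sum, hw, mul_one]
  have hsum : ∑ j, p j (μ j) = α := by
    rw [Finset.sum_congr rfl fun j _ => hμ j, ← Finset.mul_sum, hw, mul_one]
  intro j
  by_contra! hlt
  have : ∑ i, p i (μ i) < ∑ i, p i ((μ ⊔ μ') i) :=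
    Finset.sum_lt_sum (fun i _ => (hp i).monotone le_sup_left)
      ⟨j, Finset.mem_univ j, hp j (hlt.trans_le le_sup_right)⟩
  linarith

/-- There is at most one fixed point at level `α`: if both `μ` and `μ'` satisfy
`p j (μ j) = α * w j μ` for all `j`, then `μ = μ'`. -/
theorem stmt7 (m : ℕ) (hm : 1 ≤ m)
    (q α : ℝ) (hq : q ∈ Set.Ioo (0 : ℝ) 1) (hα : α ∈ Set.Ioo (0 : ℝ) 1)
    (p : Fin m → ℝ → ℝ)
    (hp_cont : ∀ j, Continuous (p j))
    (hp_mono : ∀ j, StrictMono (p j))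
    (hp_range : ∀ j t, p j t ∈ Set.Ioo (0 : ℝ) 1)
    (hp_bot : ∀ j, Tendsto (p j) atBot (nhds 0))
    (hp_top : ∀ j, Tendsto (p j) atTop (nhds 1))
    (ν : Fin m → (Fin m → ℝ) → ℝ)
    (hν_cont : ∀ j, Continuous (ν j))
    (hν_mono : ∀ j, Monotone (ν j))
    (hν_nonneg : ∀ j μ, 0 ≤ ν j μ)
    (hw_sum : ∀ μ : Fin m → ℝ, ∑ j, q ^ max (μ j) 0 * ν j μ = 1)
    (μ μ' : Fin m → ℝ)
    (hμ : ∀ j, p j (μ j) = α * (q ^ max (μ j) 0 * ν j μ))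
    (hμ' : ∀ j, p j (μ' j) = α * (q ^ max (μ' j) 0 * ν j μ')) :
    μ = μ' := by
  exact le_antisymm
    (fixedPoint_le_of_fixedPoint hq.1 hα.1 hp_mono hν_mono hw_sum hμ' hμ)
    (fixedPoint_le_of_fixedPoint hq.1 hα.1 hp_mono hν_mono hw_sum hμ hμ')
end

section
/- The confidence set C = {μ ∈ ℝ^m : p(μ) > α} is an open subset of ℝ^m. -/
open Filter Topology

/-- Division-free description of the confidence set: an index of weight zero imposes no
constraint, because the p-values are positive. -/
theorem lt_padj_iff {q α : ℝ} {m : ℕ} {p : Fin m → ℝ → ℝ}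
    {ν : Fin m → (Fin m → ℝ) → ℝ} {μ : Fin m → ℝ}
    (hp_pos : ∀ j, 0 < p j (μ j))
    (hw_nonneg : ∀ j, 0 ≤ q ^ max (μ j) 0 * ν j μ)
    (hw_pos : ∃ j, 0 < q ^ max (μ j) 0 * ν j μ) :
    α < padj q p ν μ ↔ ∀ j, α * (q ^ max (μ j) 0 * ν j μ) < p j (μ j) := by
  let S : Set ℝ := {x : ℝ | ∃ j : Fin m,
    0 < q ^ max (μ j) 0 * ν j μ ∧ x = p j (μ j) / (q ^ max (μ j) 0 * ν j μ)}
  have hfin : S.Finite := by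
    refine (Set.finite_range fun j => p j (μ j) / (q ^ max (μ j) 0 * ν j μ)).subset ?_
    rintro x ⟨j, -, rfl⟩
    exact ⟨j, rfl⟩
  have hne : S.Nonempty := by
    obtain ⟨j, hj⟩ := hw_pos
    exact ⟨_, j, hj, rfl⟩
  change α < sInf S ↔ _
  rw [hfin.lt_csInf_iff hne]
  constructor
  · intro h j
    rcases (hw_nonneg j).eq_or_lt with h0 | h0
    · rw [← h0, mul_zero]
      exact hp_pos j
    · exact (lt_div_iff₀ h0).1 (h _ ⟨j, h0, rfl⟩)
  · rintro h x ⟨j, hj, rfl⟩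
    exact (lt_div_iff₀ hj).2 (h j)

/-- The confidence set `C = {μ ∈ ℝ^m : p(μ) > α}` is an open subset of `ℝ^m`. -/
theorem stmt8 (m : ℕ) (hm : 1 ≤ m)
    (q α : ℝ) (hq : q ∈ Set.Ioo (0 : ℝ) 1) (hα : α ∈ Set.Ioo (0 : ℝ) 1)
    (p : Fin m → ℝ → ℝ)
    (hp_cont : ∀ j, Continuous (p j))
    (hp_mono : ∀ j, StrictMono (p j))
    (hp_range : ∀ j t, p j t ∈ Set.Ioo (0 : ℝ) 1)
    (hp_bot : ∀ j, Tendsto (p j) atBot (nhds 0))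
    (hp_top : ∀ j, Tendsto (p j) atTop (nhds 1))
    (ν : Fin m → (Fin m → ℝ) → ℝ)
    (hν_cont : ∀ j, Continuous (ν j))
    (hν_mono : ∀ j, Monotone (ν j))
    (hν_nonneg : ∀ j μ, 0 ≤ ν j μ)
    (hw_sum : ∀ μ : Fin m → ℝ, ∑ j, q ^ max (μ j) 0 * ν j μ = 1) :
    IsOpen {μ : Fin m → ℝ | α < padj q p ν μ} := by
  have hw_nonneg : ∀ j (μ : Fin m → ℝ), 0 ≤ q ^ max (μ j) 0 * ν j μ := fun j μ =>
    mul_nonneg (Real.rpow_nonneg hq.1.le _) (hν_nonneg j μ)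
  have hw_pos : ∀ μ : Fin m → ℝ, ∃ j, 0 < q ^ max (μ j) 0 * ν j μ := by
    intro μ
    by_contra! h
    linarith [hw_sum μ, Finset.sum_nonpos fun j (_ : j ∈ Finset.univ) => h j]
  have hw_cont : ∀ j, Continuous fun μ : Fin m → ℝ => q ^ max (μ j) 0 * ν j μ := fun j =>
    (continuous_const.rpow ((continuous_apply j).max continuous_const)
      fun _ => Or.inl hq.1.ne').mul (hν_cont j)
  have hset : {μ : Fin m → ℝ | α < padj q p ν μ} =
      ⋂ j, {μ | α * (q ^ max (μ j) 0 * ν j μ) < p j (μ j)} := by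
    ext μ
    simp only [Set.mem_ofPred_eq, Set.mem_iInter]
    exact lt_padj_iff (fun j => (hp_range j _).1) (fun j => hw_nonneg j μ) (hw_pos μ)
  rw [hset]
  exact isOpen_iInter_of_finite fun j =>
    isOpen_lt (continuous_const.mul (hw_cont j)) ((hp_cont j).comp (continuous_apply j))
end

section
/- (Theorem 2.1(a)) Let μ^(0) be a valid starting value for Algorithm 1. If μ_j^(0) ≤ L_j for all j = 1,…,m, then every iterate satisfies μ_j^(k) ≤ L_j for all k ≥ 0 and all j. -/
open Filter Topology

/-- The adjusted p-value is a lower bound for each weighted p-value when all quantities are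
positive. -/
theorem padj_le {q : ℝ} (hq : 0 < q) {m : ℕ} {p : Fin m → ℝ → ℝ}
    {ν : Fin m → (Fin m → ℝ) → ℝ} (hp : ∀ j t, 0 ≤ p j t) {θ : Fin m → ℝ} {j : Fin m}
    (hν : 0 < ν j θ) :
    padj q p ν θ ≤ p j (θ j) / (q ^ max (θ j) 0 * ν j θ) := by
  refine csInf_le ⟨0, ?_⟩ ⟨j, mul_pos (Real.rpow_pos_of_pos hq _) hν, rfl⟩
  rintro x ⟨i, hi, rfl⟩
  exact div_nonneg (hp i _) hi.le

/-- If `f` is nonnegative and monotone and `0 < q ≤ 1`, then `t ↦ f t * q ^ (-max t 0)` is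
monotone. -/
theorem monotone_mul_rpow_neg_max {q : ℝ} (hq : 0 < q) (hq1 : q ≤ 1) {f : ℝ → ℝ}
    (hf : Monotone f) (hf0 : ∀ t, 0 ≤ f t) :
    Monotone fun t => f t * q ^ (-(max t 0)) := fun _ t hst =>
  mul_le_mul (hf hst)
    (Real.rpow_le_rpow_of_exponent_ge hq hq1 (neg_le_neg (max_le_max_right 0 hst)))
    (Real.rpow_nonneg hq.le _) (hf0 t)

/-- Theorem 2.1(a): if the valid starting value `μ 0` satisfies `μ 0 j ≤ L j` for all
`j`, then every iterate of Algorithm 1 satisfies `μ k j ≤ L j` for all `k` and `j`. -/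
theorem stmt10 (m : ℕ) (hm : 1 ≤ m)
    (q α : ℝ) (hq : q ∈ Set.Ioo (0 : ℝ) 1) (hα : α ∈ Set.Ioo (0 : ℝ) 1)
    (p : Fin m → ℝ → ℝ)
    (hp_cont : ∀ j, Continuous (p j))
    (hp_mono : ∀ j, StrictMono (p j))
    (hp_range : ∀ j t, p j t ∈ Set.Ioo (0 : ℝ) 1)
    (hp_bot : ∀ j, Tendsto (p j) atBot (nhds 0))
    (hp_top : ∀ j, Tendsto (p j) atTop (nhds 1))
    (ν : Fin m → (Fin m → ℝ) → ℝ)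
    (hν_cont : ∀ j, Continuous (ν j))
    (hν_mono : ∀ j, Monotone (ν j))
    (hν_pos : ∀ j μ, 0 < ν j μ)
    (hw_sum : ∀ μ : Fin m → ℝ, ∑ j, q ^ max (μ j) 0 * ν j μ = 1)
    (hCne : {μ : Fin m → ℝ | α < padj q p ν μ}.Nonempty)
    (L : Fin m → ℝ)
    (hL : ∀ j, IsGLB ((fun μ => μ j) '' {μ : Fin m → ℝ | α < padj q p ν μ}) (L j))
    (μ : ℕ → Fin m → ℝ)
    (hstart : ∀ j, p j (μ 0 j) * q ^ (-(max (μ 0 j) 0)) ≤ ν j (μ 0) * α)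
    (hstep : ∀ k j, p j (μ (k + 1) j) * q ^ (-(max (μ (k + 1) j) 0)) = ν j (μ k) * α)
    (h0 : ∀ j, μ 0 j ≤ L j) :
    ∀ k j, μ k j ≤ L j := by
  have hp0 : ∀ j t, 0 ≤ p j t := fun j t => (hp_range j t).1.le
  intro k
  induction k with
  | zero => exact h0
  | succ k ih =>
    intro j
    refine (hL j).2 ?_
    rintro _ ⟨θ, hθ, rfl⟩
    have hle : μ k ≤ θ := fun i => (ih i).trans ((hL i).1 ⟨θ, hθ, rfl⟩)
    have hqpos := Real.rpow_pos_of_pos hq.1 (max (θ j) 0)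
    have hlt : α < p j (θ j) / (q ^ max (θ j) 0 * ν j θ) :=
      lt_of_lt_of_le hθ (padj_le hq.1 hp0 (hν_pos j θ))
    rw [lt_div_iff₀ (mul_pos hqpos (hν_pos j θ))] at hlt
    have hθlt : ν j θ * α < p j (θ j) * q ^ (-(max (θ j) 0)) := by
      rw [Real.rpow_neg hq.1.le, ← div_eq_mul_inv, lt_div_iff₀ hqpos]
      linarith
    refine ((monotone_mul_rpow_neg_max hq.1 hq.2.le (hp_mono j).monotone (hp0 j)).reflect_lt ?_).le
    calc p j (μ (k + 1) j) * q ^ (-(max (μ (k + 1) j) 0)) = ν j (μ k) * α := hstep k j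
      _ ≤ ν j θ * α := mul_le_mul_of_nonneg_right (hν_mono j hle) hα.1.le
      _ < _ := hθlt
end

section
/- (Theorem 2.1(b)) The limit of Algorithm 1 is independent of the starting value: if μ^(0) and μ̃^(0) are both valid starting values, then the limits μ^∞ and μ̃^∞ of the corresponding sequences of iterates coincide. -/
open Filter Topology

/-- The limit of the iterates solves the fixed point equation. -/
lemma fixed_point_of_tendsto {ι : Type*} {q α : ℝ} (hq : 0 < q) {p : ι → ℝ → ℝ}
    {ν : ι → (ι → ℝ) → ℝ} (hp : ∀ j, Continuous (p j)) (hν : ∀ j, Continuous (ν j))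
    {μ : ℕ → ι → ℝ} {a : ι → ℝ}
    (hstep : ∀ k j, p j (μ (k + 1) j) * q ^ (-(max (μ (k + 1) j) 0)) = ν j (μ k) * α)
    (hlim : ∀ j, Tendsto (fun k => μ k j) atTop (𝓝 (a j))) (j : ι) :
    p j (a j) * q ^ (-(max (a j) 0)) = ν j a * α := by
  have hcont : Continuous fun t : ℝ => p j t * q ^ (-(max t 0)) :=
    (hp j).mul (continuous_const.rpow (by fun_prop) fun _ => Or.inl hq.ne')
  have hleft := (hcont.tendsto (a j)).comp ((hlim j).comp (tendsto_add_atTop_nat 1))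
  have hright := (((hν j).tendsto a).comp (tendsto_pi_nhds.2 hlim)).mul_const α
  exact tendsto_nhds_unique hleft (hright.congr fun k => (hstep k j).symm)

/-- Clearing the factor `q ^ (-x)` from an inequality. -/
lemma le_rpow_mul_of_mul_rpow_neg_le {q x s t : ℝ} (hq : 0 < q) (h : s * q ^ (-x) ≤ t) :
    s ≤ q ^ x * t := by
  rwa [Real.rpow_neg hq.le, ← div_eq_mul_inv, div_le_iff₀' (Real.rpow_pos_of_pos hq x)] at h

/-- No valid starting value lies strictly above a solution of the fixed point equation. -/
lemma eq_of_fixed_point_of_le {ι : Type*} [Fintype ι] {q α : ℝ} (hq : 0 < q)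
    {p : ι → ℝ → ℝ} (hp : ∀ j, StrictMono (p j)) {ν : ι → (ι → ℝ) → ℝ}
    (hw : ∀ μ : ι → ℝ, ∑ j, q ^ max (μ j) 0 * ν j μ = 1) {a c : ι → ℝ}
    (ha : ∀ j, p j (a j) * q ^ (-(max (a j) 0)) = ν j a * α)
    (hc : ∀ j, p j (c j) * q ^ (-(max (c j) 0)) ≤ ν j c * α) (hac : a ≤ c) : a = c := by
  have sum_weights (x : ι → ℝ) : ∑ j, q ^ max (x j) 0 * (ν j x * α) = α := by
    simp_rw [← mul_assoc, ← Finset.sum_mul, hw, one_mul]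
  have sum_c : ∑ j, p j (c j) ≤ α :=
    (Finset.sum_le_sum fun j _ => le_rpow_mul_of_mul_rpow_neg_le hq (hc j)).trans_eq
      (sum_weights c)
  have sum_a : ∑ j, p j (a j) = α := by
    rw [← sum_weights a]
    refine Finset.sum_congr rfl fun j _ => ?_
    rw [← ha j, mul_left_comm, ← Real.rpow_add hq, add_neg_cancel, Real.rpow_zero, mul_one]
  have hle : ∀ j ∈ Finset.univ, p j (a j) ≤ p j (c j) := fun j _ => (hp j).monotone (hac j)
  have heq := (Finset.sum_eq_sum_iff_of_le hle).1
    ((Finset.sum_le_sum hle).antisymm (sum_c.trans_eq sum_a.symm))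
  exact funext fun j => (hp j).injective (heq j (Finset.mem_univ j))

/-- The supremum of two valid starting values is a valid starting value. -/
lemma valid_sup {ι : Type*} {q α : ℝ} (hα : 0 ≤ α) {p : ι → ℝ → ℝ}
    {ν : ι → (ι → ℝ) → ℝ} (hν : ∀ j, Monotone (ν j)) {a b : ι → ℝ}
    (ha : ∀ j, p j (a j) * q ^ (-(max (a j) 0)) ≤ ν j a * α)
    (hb : ∀ j, p j (b j) * q ^ (-(max (b j) 0)) ≤ ν j b * α) (j : ι) :
    p j ((a ⊔ b) j) * q ^ (-(max ((a ⊔ b) j) 0)) ≤ ν j (a ⊔ b) * α := by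
  rcases le_total (a j) (b j) with h | h
  · rw [Pi.sup_apply, sup_eq_right.2 h]
    exact (hb j).trans (mul_le_mul_of_nonneg_right (hν j le_sup_right) hα)
  · rw [Pi.sup_apply, sup_eq_left.2 h]
    exact (ha j).trans (mul_le_mul_of_nonneg_right (hν j le_sup_left) hα)

/-- Theorem 2.1(b): the limit of Algorithm 1 is independent of the starting value. If
`μ` and `μ'` are sequences of iterates of Algorithm 1 started at two (possibly
different) valid starting values, converging to `μinf` and `μinf'` respectively, then
`μinf = μinf'`. -/
theorem stmt11 (m : ℕ) (hm : 1 ≤ m)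
    (q α : ℝ) (hq : q ∈ Set.Ioo (0 : ℝ) 1) (hα : α ∈ Set.Ioo (0 : ℝ) 1)
    (p : Fin m → ℝ → ℝ)
    (hp_cont : ∀ j, Continuous (p j))
    (hp_mono : ∀ j, StrictMono (p j))
    (hp_range : ∀ j t, p j t ∈ Set.Ioo (0 : ℝ) 1)
    (hp_bot : ∀ j, Tendsto (p j) atBot (nhds 0))
    (hp_top : ∀ j, Tendsto (p j) atTop (nhds 1))
    (ν : Fin m → (Fin m → ℝ) → ℝ)
    (hν_cont : ∀ j, Continuous (ν j))
    (hν_mono : ∀ j, Monotone (ν j))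
    (hν_pos : ∀ j μ, 0 < ν j μ)
    (hw_sum : ∀ μ : Fin m → ℝ, ∑ j, q ^ max (μ j) 0 * ν j μ = 1)
    (μ μ' : ℕ → Fin m → ℝ)
    (hstart : ∀ j, p j (μ 0 j) * q ^ (-(max (μ 0 j) 0)) ≤ ν j (μ 0) * α)
    (hstep : ∀ k j, p j (μ (k + 1) j) * q ^ (-(max (μ (k + 1) j) 0)) = ν j (μ k) * α)
    (hstart' : ∀ j, p j (μ' 0 j) * q ^ (-(max (μ' 0 j) 0)) ≤ ν j (μ' 0) * α)
    (hstep' : ∀ k j, p j (μ' (k + 1) j) * q ^ (-(max (μ' (k + 1) j) 0)) = ν j (μ' k) * α)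
    (μinf μinf' : Fin m → ℝ)
    (hlim : ∀ j, Tendsto (fun k => μ k j) atTop (nhds (μinf j)))
    (hlim' : ∀ j, Tendsto (fun k => μ' k j) atTop (nhds (μinf' j))) :
    μinf = μinf' := by
  have ha := fixed_point_of_tendsto hq.1 hp_cont hν_cont hstep hlim
  have hb := fixed_point_of_tendsto hq.1 hp_cont hν_cont hstep' hlim'
  have hc := valid_sup hα.1.le hν_mono (fun j => (ha j).le) fun j => (hb j).le
  exact (eq_of_fixed_point_of_le hq.1 hp_mono hw_sum ha hc le_sup_left).trans
    (eq_of_fixed_point_of_le hq.1 hp_mono hw_sum hb hc le_sup_right).symm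
end

section
/- (Theorem 2.1(c)) For any valid starting value μ^(0), the limit μ^∞ of the iterates of Algorithm 1 satisfies μ_j^∞ ≥ L_j for all j = 1,…,m. -/
open Filter Topology

/-- A point `a` with `p j (a j) ≤ β * w j a` for all `j` lies below a point where all these
inequalities are equalities, provided the weights sum to one and each `w j` is non-decreasing in
the coordinates other than the `j`-th. -/
theorem exists_ge_forall_eq_mul_weight {ι : Type*} [Fintype ι] [DecidableEq ι]
    {p : ι → ℝ → ℝ} {w : ι → (ι → ℝ) → ℝ} {β : ℝ} {a : ι → ℝ}
    (hp_cont : ∀ j, Continuous (p j)) (hp_mono : ∀ j, StrictMono (p j))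
    (hp_nonneg : ∀ j t, 0 ≤ p j t) (hp_top : ∀ j, Tendsto (p j) atTop (𝓝 1))
    (hw_cont : ∀ j, Continuous (w j))
    (hw_mono : ∀ j i μ t, j ≠ i → μ i ≤ t → w j μ ≤ w j (Function.update μ i t))
    (hw_sum : ∀ μ, ∑ j, w j μ = 1) (hβ : β < 1) (ha : ∀ j, p j (a j) ≤ β * w j a) :
    ∃ μ, a ≤ μ ∧ ∀ j, p j (μ j) = β * w j μ := by
  choose b hb using fun j => ((hp_top j).eventually (lt_mem_nhds hβ)).exists
  let S : Set (ι → ℝ) := {μ | a ≤ μ ∧ ∀ j, p j (μ j) ≤ β * w j μ}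
  have hS_closed : IsClosed S := by
    have h : S = Set.Ici a ∩ ⋂ j, {μ | p j (μ j) ≤ β * w j μ} := by ext; simp [S]
    rw [h]
    exact isClosed_Ici.inter <| isClosed_iInter fun j => isClosed_le
      ((hp_cont j).comp (continuous_apply j)) (continuous_const.mul (hw_cont j))
  have hS_sub : S ⊆ Set.Icc a b := by
    rintro μ ⟨haμ, hμ⟩
    refine ⟨haμ, fun j => (hp_mono j).le_iff_le.1 (le_trans ?_ (hb j).le)⟩
    calc p j (μ j) ≤ ∑ i, p i (μ i) :=
          Finset.single_le_sum (f := fun i => p i (μ i)) (fun i _ => hp_nonneg i _)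
            (Finset.mem_univ j)
      _ ≤ ∑ i, β * w i μ := Finset.sum_le_sum fun i _ => hμ i
      _ = β := by rw [← Finset.mul_sum, hw_sum, mul_one]
  obtain ⟨μ, ⟨haμ, hμ⟩, hmax⟩ := (isCompact_Icc.of_isClosed_subset hS_closed hS_sub).exists_isMaxOn
    ⟨a, le_rfl, ha⟩ (f := fun μ => ∑ i, p i (μ i))
    (continuous_finsetSum _ fun i _ => (hp_cont i).comp (continuous_apply i)).continuousOn
  refine ⟨μ, haμ, fun i => (hμ i).antisymm (not_lt.1 fun hlt => ?_)⟩
  have hβ_nonneg : 0 ≤ β := by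
    have h := Finset.sum_le_sum fun j (_ : j ∈ Finset.univ) => (hp_nonneg j _).trans (hμ j)
    rwa [← Finset.mul_sum, hw_sum, mul_one, Finset.sum_const_zero] at h
  have hupd : Continuous fun t => Function.update μ i t := continuous_const.update i continuous_id
  have hnear : ∀ᶠ t in 𝓝 (μ i), p i t < β * w i (Function.update μ i t) :=
    (hp_cont i).continuousAt.eventually_lt
      (continuous_const.mul ((hw_cont i).comp hupd)).continuousAt (by simpa using hlt)
  obtain ⟨t, ht, hμt⟩ := ((hnear.filter_mono nhdsWithin_le_nhds).and
    (self_mem_nhdsWithin (s := Set.Ioi (μ i)))).exists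
  have hμt : μ i < t := hμt
  have hle : μ ≤ Function.update μ i t := by simpa using hμt.le
  have hmem : Function.update μ i t ∈ S := by
    refine ⟨haμ.trans hle, fun j => ?_⟩
    rcases eq_or_ne j i with rfl | hji
    · simpa using ht.le
    · rw [Function.update_of_ne hji]
      exact (hμ j).trans (mul_le_mul_of_nonneg_left (hw_mono j i μ t hji hμt.le) hβ_nonneg)
  refine absurd (isMaxOn_iff.1 hmax _ hmem) (not_le.2 ?_)
  exact Finset.sum_lt_sum (fun j _ => (hp_mono j).monotone (hle j))
    ⟨i, Finset.mem_univ i, by simpa using hp_mono i hμt⟩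

/-- The adjusted p-value equals `β` when all the weighted p-values do. -/
theorem padj_eq_of_forall_eq_mul {q β : ℝ} (hq : 0 < q) {m : ℕ} (hm : 1 ≤ m)
    {p : Fin m → ℝ → ℝ} {ν : Fin m → (Fin m → ℝ) → ℝ} (hν_pos : ∀ j μ, 0 < ν j μ)
    {μ : Fin m → ℝ} (hμ : ∀ j, p j (μ j) = β * (q ^ max (μ j) 0 * ν j μ)) :
    padj q p ν μ = β := by
  have hw (j : Fin m) : 0 < q ^ max (μ j) 0 * ν j μ :=
    mul_pos (Real.rpow_pos_of_pos hq _) (hν_pos j μ)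
  have hdiv (j : Fin m) : p j (μ j) / (q ^ max (μ j) 0 * ν j μ) = β := by
    rw [hμ, mul_div_cancel_right₀ _ (hw j).ne']
  have hset : {x : ℝ | ∃ j : Fin m,
      0 < q ^ max (μ j) 0 * ν j μ ∧ x = p j (μ j) / (q ^ max (μ j) 0 * ν j μ)} = {β} := by
    ext x
    constructor
    · rintro ⟨j, -, rfl⟩
      exact hdiv j
    · rintro rfl
      exact ⟨⟨0, hm⟩, hw _, (hdiv _).symm⟩
  rw [padj, hset, csInf_singleton]

/-- Theorem 2.1(c): for any valid starting value, the limit `μ^∞` of the iterates of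
Algorithm 1 satisfies `μ^∞ j ≥ L j` for all `j`, where `L j` is the infimum of the
`j`-th coordinates of the confidence set `C = {μ : p(μ) > α}`. -/
theorem stmt12 (m : ℕ) (hm : 1 ≤ m)
    (q α : ℝ) (hq : q ∈ Set.Ioo (0 : ℝ) 1) (hα : α ∈ Set.Ioo (0 : ℝ) 1)
    (p : Fin m → ℝ → ℝ)
    (hp_cont : ∀ j, Continuous (p j))
    (hp_mono : ∀ j, StrictMono (p j))
    (hp_range : ∀ j t, p j t ∈ Set.Ioo (0 : ℝ) 1)
    (hp_bot : ∀ j, Tendsto (p j) atBot (nhds 0))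
    (hp_top : ∀ j, Tendsto (p j) atTop (nhds 1))
    (ν : Fin m → (Fin m → ℝ) → ℝ)
    (hν_cont : ∀ j, Continuous (ν j))
    (hν_mono : ∀ j, Monotone (ν j))
    (hν_pos : ∀ j μ, 0 < ν j μ)
    (hw_sum : ∀ μ : Fin m → ℝ, ∑ j, q ^ max (μ j) 0 * ν j μ = 1)
    (L : Fin m → ℝ)
    (hL : ∀ j, IsGLB ((fun μ => μ j) '' {μ : Fin m → ℝ | α < padj q p ν μ}) (L j))
    (μ : ℕ → Fin m → ℝ)
    (hstart : ∀ j, p j (μ 0 j) * q ^ (-(max (μ 0 j) 0)) ≤ ν j (μ 0) * α)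
    (hstep : ∀ k j, p j (μ (k + 1) j) * q ^ (-(max (μ (k + 1) j) 0)) = ν j (μ k) * α)
    (μinf : Fin m → ℝ)
    (hlim : ∀ j, Tendsto (fun k => μ k j) atTop (nhds (μinf j))) :
    ∀ j, L j ≤ μinf j := by
  intro i
  obtain ⟨hq0, hq1⟩ := hq
  obtain ⟨hα0, hα1⟩ := hα
  let w : Fin m → (Fin m → ℝ) → ℝ := fun j μ => q ^ max (μ j) 0 * ν j μ
  have hw_pos (j μ) : 0 < w j μ := mul_pos (Real.rpow_pos_of_pos hq0 _) (hν_pos j μ)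
  have hpow : Continuous fun t : ℝ => q ^ t := Real.continuous_const_rpow hq0.ne'
  have hw_cont (j) : Continuous (w j) :=
    (hpow.comp ((continuous_apply j).max continuous_const)).mul (hν_cont j)
  have hw_mono (j i μ t) (hji : j ≠ i) (ht : μ i ≤ t) :
      w j μ ≤ w j (Function.update μ i t) := by
    simp only [w, Function.update_of_ne hji]
    exact mul_le_mul_of_nonneg_left (hν_mono j (by simpa using ht))
      (Real.rpow_nonneg hq0.le _)
  have hfix (j) : p j (μinf j) = α * w j μinf := by
    have hleft : Tendsto (fun k => p j (μ (k + 1) j) * q ^ (-(max (μ (k + 1) j) 0))) atTop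
        (𝓝 (p j (μinf j) * q ^ (-(max (μinf j) 0)))) :=
      (((hp_cont j).mul (hpow.comp (continuous_id.max continuous_const).neg)).tendsto
        (μinf j)).comp ((hlim j).comp (tendsto_add_atTop_nat 1))
    have hright : Tendsto (fun k => ν j (μ k) * α) atTop (𝓝 (ν j μinf * α)) :=
      (((hν_cont j).tendsto μinf).comp (tendsto_pi_nhds.2 hlim)).mul_const α
    simp only [hstep] at hleft
    have h := tendsto_nhds_unique hleft hright
    have hq' : 0 < q ^ max (μinf j) 0 := Real.rpow_pos_of_pos hq0 _
    rw [Real.rpow_neg hq0.le] at h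
    field_simp at h
    simp only [w]
    linarith
  by_contra! hlt
  obtain ⟨β, hαβ, hβ⟩ : ∃ β, α < β ∧ β < min 1 (α + (p i (L i) - p i (μinf i))) :=
    exists_between (lt_min hα1 (by linarith [hp_mono i hlt]))
  obtain ⟨hβ1, hβ_gap⟩ := lt_min_iff.1 hβ
  obtain ⟨x, hx, hxeq⟩ := exists_ge_forall_eq_mul_weight hp_cont hp_mono
    (fun j t => (hp_range j t).1.le) hp_top hw_cont hw_mono hw_sum hβ1
    (fun j => (hfix j).trans_le (mul_le_mul_of_nonneg_right hαβ.le (hw_pos j μinf).le))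
  have hLx : L i ≤ x i := (hL i).1 ⟨x, by
    rwa [Set.mem_ofPred_eq, padj_eq_of_forall_eq_mul hq0 hm hν_pos hxeq], rfl⟩
  have hsum : ∑ j, (p j (x j) - p j (μinf j)) = β - α := by
    simp_rw [hxeq, hfix, Finset.sum_sub_distrib, ← Finset.mul_sum]
    simp only [w, hw_sum, mul_one]
  have hle : p i (x i) - p i (μinf i) ≤ β - α := hsum ▸
    Finset.single_le_sum (f := fun j => p j (x j) - p j (μinf j))
      (fun j _ => sub_nonneg.2 ((hp_mono j).monotone (hx j))) (Finset.mem_univ i)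
  linarith [(hp_mono i).monotone hLx]
end

section
/- (Proposition B.1(a)) The fixed points are strictly increasing in the level: let u, u′ ∈ (0,1) with u < u′, and suppose μ ∈ ℝ^m satisfies p_j(μ_j) = u · w_j(μ) for all j and μ′ ∈ ℝ^m satisfies p_j(μ′_j) = u′ · w_j(μ′) for all j. Then μ_j ≤ μ′_j for all j = 1,…,m, and μ ≠ μ′. -/
open Filter Topology

/-- Proposition B.1(a): the fixed points are strictly increasing in the level. If
`u < u'` in `(0,1)`, `μ` is a fixed point at level `u` and `μ'` a fixed point at level
`u'`, then `μ j ≤ μ' j` for all `j` and `μ ≠ μ'`. -/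
theorem stmt14 (m : ℕ) (hm : 1 ≤ m)
    (q α : ℝ) (hq : q ∈ Set.Ioo (0 : ℝ) 1) (hα : α ∈ Set.Ioo (0 : ℝ) 1)
    (p : Fin m → ℝ → ℝ)
    (hp_cont : ∀ j, Continuous (p j))
    (hp_mono : ∀ j, StrictMono (p j))
    (hp_range : ∀ j t, p j t ∈ Set.Ioo (0 : ℝ) 1)
    (hp_bot : ∀ j, Tendsto (p j) atBot (nhds 0))
    (hp_top : ∀ j, Tendsto (p j) atTop (nhds 1))
    (ν : Fin m → (Fin m → ℝ) → ℝ)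
    (hν_cont : ∀ j, Continuous (ν j))
    (hν_mono : ∀ j, Monotone (ν j))
    (hν_pos : ∀ j μ, 0 < ν j μ)
    (hw_sum : ∀ μ : Fin m → ℝ, ∑ j, q ^ max (μ j) 0 * ν j μ = 1)
    (u u' : ℝ) (hu : u ∈ Set.Ioo (0 : ℝ) 1) (hu' : u' ∈ Set.Ioo (0 : ℝ) 1)
    (huu' : u < u')
    (μ μ' : Fin m → ℝ)
    (hμ : ∀ j, p j (μ j) = u * (q ^ max (μ j) 0 * ν j μ))
    (hμ' : ∀ j, p j (μ' j) = u' * (q ^ max (μ' j) 0 * ν j μ')) :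
    (∀ j, μ j ≤ μ' j) ∧ μ ≠ μ' := by
  have hq_nonneg : ∀ x : ℝ, 0 ≤ q ^ x := fun x => Real.rpow_nonneg hq.1.le x
  constructor
  · by_contra! hne
    obtain ⟨k, hk⟩ := hne
    let S : Finset (Fin m) := Finset.univ.filter fun j => μ' j < μ j
    have hw_mu : ∑ j ∈ S, q ^ max (μ j) 0 * ν j μ
        ≤ ∑ j ∈ S, q ^ max ((μ ⊔ μ') j) 0 * ν j (μ ⊔ μ') := by
      refine Finset.sum_le_sum fun j hj => ?_
      rw [Pi.sup_apply, sup_eq_left.2 (Finset.mem_filter.1 hj).2.le]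
      exact mul_le_mul_of_nonneg_left (hν_mono j le_sup_left) (hq_nonneg _)
    have hw_compl : ∑ j ∈ Sᶜ, q ^ max (μ' j) 0 * ν j μ'
        ≤ ∑ j ∈ Sᶜ, q ^ max ((μ ⊔ μ') j) 0 * ν j (μ ⊔ μ') := by
      refine Finset.sum_le_sum fun j hj => ?_
      have hle : μ j ≤ μ' j := by simpa [S] using hj
      rw [Pi.sup_apply, sup_eq_right.2 hle]
      exact mul_le_mul_of_nonneg_left (hν_mono j le_sup_right) (hq_nonneg _)
    have hsum_sup := hw_sum (μ ⊔ μ')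
    have hsum' := hw_sum μ'
    rw [← Finset.sum_add_sum_compl S] at hsum_sup hsum'
    have hp_lt : ∑ j ∈ S, p j (μ' j) < ∑ j ∈ S, p j (μ j) :=
      Finset.sum_lt_sum_of_nonempty ⟨k, by simpa [S] using hk⟩
        fun j hj => hp_mono j (Finset.mem_filter.1 hj).2
    simp only [hμ, hμ', ← Finset.mul_sum] at hp_lt
    have hw_le : ∑ j ∈ S, q ^ max (μ j) 0 * ν j μ
        ≤ ∑ j ∈ S, q ^ max (μ' j) 0 * ν j μ' := by linarith
    exact hp_lt.not_ge (mul_le_mul huu'.le hw_le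
      (Finset.sum_nonneg fun j _ => mul_nonneg (hq_nonneg _) (hν_pos j _).le) hu'.1.le)
  · rintro rfl
    have hpos : 0 < q ^ max (μ ⟨0, hm⟩) 0 * ν ⟨0, hm⟩ μ :=
      mul_pos (Real.rpow_pos_of_pos hq.1 _) (hν_pos _ _)
    have heq := (hμ ⟨0, hm⟩).symm.trans (hμ' ⟨0, hm⟩)
    exact huu'.ne (mul_right_cancel₀ hpos.ne' heq)
end

section
/- (Proposition B.1(b)) Let I ⊆ (0,1) be an interval and suppose that for every u ∈ I there exists a (necessarily unique) vector φ(u) ∈ ℝ^m with p_j(φ_j(u)) = u · w_j(φ(u)) for all j = 1,…,m. Then the map φ : I → ℝ^m is continuous, i.e., for every sequence u_n ∈ I with u_n → u ∈ I we have φ(u_n) → φ(u). -/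
open Filter Topology

/-- Solutions of `p j (x j) = u * (q ^ max (x j) 0 * ν j x)` are monotone in the level `u`, provided
the weights `q ^ max (x j) 0 * ν j x` sum to one. -/
theorem solution_le_solution {ι : Type*} [Fintype ι] {q u v : ℝ} (hq : 0 ≤ q)
    {p : ι → ℝ → ℝ} (hp : ∀ j, StrictMono (p j))
    {ν : ι → (ι → ℝ) → ℝ} (hν : ∀ j, Monotone (ν j)) (hν_nonneg : ∀ j x, 0 ≤ ν j x)
    (hsum : ∀ x : ι → ℝ, ∑ j, q ^ max (x j) 0 * ν j x = 1)
    {x y : ι → ℝ} (hu : 0 < u) (huv : u ≤ v)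
    (hx : ∀ j, p j (x j) = u * (q ^ max (x j) 0 * ν j x))
    (hy : ∀ j, p j (y j) = v * (q ^ max (y j) 0 * ν j y)) : x ≤ y := by
  by_contra h
  obtain ⟨i, hi⟩ : ∃ i, y i < x i := by simpa [Pi.le_def] using h
  have lt_of_lt : ∀ j, y j < x j →
      q ^ max (y j) 0 * ν j y < q ^ max ((x ⊔ y) j) 0 * ν j (x ⊔ y) := by
    intro j hj
    have hM : (x ⊔ y) j = x j := max_eq_left hj.le
    rw [hM]
    have hlt := hp j hj
    rw [hx, hy] at hlt
    have hle : u * (q ^ max (y j) 0 * ν j y) ≤ v * (q ^ max (y j) 0 * ν j y) :=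
      mul_le_mul_of_nonneg_right huv (mul_nonneg (Real.rpow_nonneg hq _) (hν_nonneg j y))
    calc q ^ max (y j) 0 * ν j y < q ^ max (x j) 0 * ν j x :=
          lt_of_mul_lt_mul_left (hle.trans_lt hlt) hu.le
      _ ≤ q ^ max (x j) 0 * ν j (x ⊔ y) :=
          mul_le_mul_of_nonneg_left (hν j le_sup_left) (Real.rpow_nonneg hq _)
  have hlt : ∑ j, q ^ max (y j) 0 * ν j y < ∑ j, q ^ max ((x ⊔ y) j) 0 * ν j (x ⊔ y) := by
    refine Finset.sum_lt_sum (fun j _ => ?_) ⟨i, Finset.mem_univ i, lt_of_lt i hi⟩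
    rcases lt_or_ge (y j) (x j) with hj | hj
    · exact (lt_of_lt j hj).le
    · have hM : (x ⊔ y) j = y j := max_eq_right hj
      rw [hM]
      exact mul_le_mul_of_nonneg_left (hν j le_sup_right) (Real.rpow_nonneg hq _)
  rw [hsum, hsum] at hlt
  exact lt_irrefl _ hlt

/-- Proposition B.1(b): if on an interval `I ⊆ (0,1)` every level `u ∈ I` admits a
fixed point `φ u` (i.e. `p j (φ u j) = u * w j (φ u)` for all `j`), then the map `φ`
is continuous on `I`: for every sequence `u_n ∈ I` converging to `u ∈ I`, we have
`φ (u_n) → φ u`. -/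
theorem stmt15 (m : ℕ) (hm : 1 ≤ m)
    (q α : ℝ) (hq : q ∈ Set.Ioo (0 : ℝ) 1) (hα : α ∈ Set.Ioo (0 : ℝ) 1)
    (p : Fin m → ℝ → ℝ)
    (hp_cont : ∀ j, Continuous (p j))
    (hp_mono : ∀ j, StrictMono (p j))
    (hp_range : ∀ j t, p j t ∈ Set.Ioo (0 : ℝ) 1)
    (hp_bot : ∀ j, Tendsto (p j) atBot (nhds 0))
    (hp_top : ∀ j, Tendsto (p j) atTop (nhds 1))
    (ν : Fin m → (Fin m → ℝ) → ℝ)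
    (hν_cont : ∀ j, Continuous (ν j))
    (hν_mono : ∀ j, Monotone (ν j))
    (hν_pos : ∀ j μ, 0 < ν j μ)
    (hw_sum : ∀ μ : Fin m → ℝ, ∑ j, q ^ max (μ j) 0 * ν j μ = 1)
    (I : Set ℝ) (hIsub : I ⊆ Set.Ioo (0 : ℝ) 1) (hIint : I.OrdConnected)
    (φ : ℝ → Fin m → ℝ)
    (hφ : ∀ u ∈ I, ∀ j, p j (φ u j) = u * (q ^ max (φ u j) 0 * ν j (φ u))) :
    ∀ u ∈ I, ∀ s : ℕ → ℝ, (∀ n, s n ∈ I) → Tendsto s atTop (nhds u) →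
      Tendsto (fun n => φ (s n)) atTop (nhds (φ u)) := by
  intro u hu s hs hsu
  have hle : ∀ {a b : ℝ} {x y : Fin m → ℝ}, 0 < a → a ≤ b →
      (∀ j, p j (x j) = a * (q ^ max (x j) 0 * ν j x)) →
      (∀ j, p j (y j) = b * (q ^ max (y j) 0 * ν j y)) → x ≤ y :=
    solution_le_solution hq.1.le hp_mono hν_mono (fun j x => (hν_pos j x).le) hw_sum
  have hK : IsCompact (insert u (Set.range s)) := hsu.isCompact_insert_range
  have hKI : insert u (Set.range s) ⊆ I := Set.insert_subset hu (Set.range_subset_iff.2 hs)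
  obtain ⟨a, haK, ha⟩ := hK.exists_isLeast (Set.insert_nonempty _ _)
  obtain ⟨b, hbK, hb⟩ := hK.exists_isGreatest (Set.insert_nonempty _ _)
  have hmem : ∀ n, φ (s n) ∈ Set.Icc (φ a) (φ b) := fun n =>
    ⟨hle (hIsub (hKI haK)).1 (ha (Or.inr ⟨n, rfl⟩)) (hφ a (hKI haK)) (hφ _ (hs n)),
      hle (hIsub (hs n)).1 (hb (Or.inr ⟨n, rfl⟩)) (hφ _ (hs n)) (hφ b (hKI hbK))⟩
  refine tendsto_of_subseq_tendsto fun k hk => ?_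
  obtain ⟨x, -, l, hl, hx⟩ := isCompact_Icc.tendsto_subseq fun n => hmem (k n)
  have hsl : Tendsto (fun n => s (k (l n))) atTop (nhds u) :=
    hsu.comp (hk.comp hl.tendsto_atTop)
  have hxu : ∀ j, p j (x j) = u * (q ^ max (x j) 0 * ν j x) := by
    intro j
    have hleft : Continuous fun z : Fin m → ℝ => p j (z j) :=
      (hp_cont j).comp (continuous_apply j)
    have hright : Continuous fun z : Fin m → ℝ => q ^ max (z j) 0 * ν j z :=
      ((Real.continuous_const_rpow hq.1.ne').comp
        ((continuous_apply j).max continuous_const)).mul (hν_cont j)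
    refine tendsto_nhds_unique ((hleft.tendsto x).comp hx) ?_
    exact (hsl.mul ((hright.tendsto x).comp hx)).congr fun n => (hφ _ (hs _) j).symm
  have hxφ : x = φ u :=
    le_antisymm (hle (hIsub hu).1 le_rfl hxu (hφ u hu)) (hle (hIsub hu).1 le_rfl (hφ u hu) hxu)
  exact ⟨l, hxφ ▸ hx⟩
end

section
/- (Informativeness, Proposition 2.2(b)) Fix an index i ∈ {1,…,m}. Let (p_j)_{j=1,…,m} and (p′_j)_{j=1,…,m} be two families of shifted p-value functions, each satisfying the standing assumptions, such that p′_i(t) < p_i(t) for all t ∈ ℝ and p′_j(t) ≤ p_j(t) for all t ∈ ℝ and all j ≠ i. Suppose L ∈ ℝ^m satisfies p_j(L_j) = α · w_j(L) for all j, and L′ ∈ ℝ^m satisfies p′_j(L′_j) = α · w_j(L′) for all j. Then L′_j ≥ L_j for all j = 1,…,m and L′_i > L_i; that is, the lower confidence bound for the i-th hypothesis strictly increases when the evidence against it strictly increases and the evidence against the other hypotheses does not decrease. -/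
open Filter Topology

/-- Informativeness (Proposition 2.2(b)): if the second family of p-value functions
`p'` provides strictly more evidence against `H_i` (i.e. `p' i < p i` pointwise) and no
less evidence against the other hypotheses (`p' j ≤ p j` pointwise for `j ≠ i`), then
the fixed points `L` and `L'` at level `α` of the two families satisfy `L' j ≥ L j`
for all `j` and `L' i > L i`. -/
theorem stmt16 (m : ℕ) (hm : 1 ≤ m) (i : Fin m)
    (q α : ℝ) (hq : q ∈ Set.Ioo (0 : ℝ) 1) (hα : α ∈ Set.Ioo (0 : ℝ) 1)
    (p p' : Fin m → ℝ → ℝ)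
    (hp_cont : ∀ j, Continuous (p j))
    (hp_mono : ∀ j, StrictMono (p j))
    (hp_range : ∀ j t, p j t ∈ Set.Ioo (0 : ℝ) 1)
    (hp_bot : ∀ j, Tendsto (p j) atBot (nhds 0))
    (hp_top : ∀ j, Tendsto (p j) atTop (nhds 1))
    (hp'_cont : ∀ j, Continuous (p' j))
    (hp'_mono : ∀ j, StrictMono (p' j))
    (hp'_range : ∀ j t, p' j t ∈ Set.Ioo (0 : ℝ) 1)
    (hp'_bot : ∀ j, Tendsto (p' j) atBot (nhds 0))
    (hp'_top : ∀ j, Tendsto (p' j) atTop (nhds 1))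
    (hp'_lt_i : ∀ t, p' i t < p i t)
    (hp'_le : ∀ j, j ≠ i → ∀ t, p' j t ≤ p j t)
    (ν : Fin m → (Fin m → ℝ) → ℝ)
    (hν_cont : ∀ j, Continuous (ν j))
    (hν_mono : ∀ j, Monotone (ν j))
    (hν_pos : ∀ j μ, 0 < ν j μ)
    (hw_sum : ∀ μ : Fin m → ℝ, ∑ j, q ^ max (μ j) 0 * ν j μ = 1)
    (L L' : Fin m → ℝ)
    (hL : ∀ j, p j (L j) = α * (q ^ max (L j) 0 * ν j L))
    (hL' : ∀ j, p' j (L' j) = α * (q ^ max (L' j) 0 * ν j L')) :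
    (∀ j, L j ≤ L' j) ∧ L i < L' i := by
  have hq0 : ∀ x : ℝ, 0 ≤ q ^ x := fun x => Real.rpow_nonneg hq.1.le x
  have hle : ∀ j t, p' j t ≤ p j t := fun j t => by
    by_cases h : j = i
    · subst h
      exact (hp'_lt_i t).le
    · exact hp'_le j h t
  have hw_le : ∀ j (a b : Fin m → ℝ), a ≤ b → b j = a j →
      q ^ max (a j) 0 * ν j a ≤ q ^ max (b j) 0 * ν j b := fun j a b hab h => by
    rw [h]
    exact mul_le_mul_of_nonneg_left (hν_mono j hab) (hq0 _)
  have hw_lt : ∀ j, L' j < L j →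
      q ^ max (L' j) 0 * ν j L' < q ^ max ((L ⊔ L') j) 0 * ν j (L ⊔ L') := fun j h => by
    refine lt_of_lt_of_le ?_ (hw_le j L (L ⊔ L') le_sup_left (by simp [h.le]))
    refine lt_of_mul_lt_mul_left ?_ hα.1.le
    rw [← hL, ← hL']
    exact (hle j _).trans_lt (hp_mono j h)
  have hLL' : ∀ j, L j ≤ L' j := by
    by_contra! ⟨k, hk⟩
    have hsum := Finset.sum_lt_sum (s := Finset.univ)
      (f := fun j => q ^ max (L' j) 0 * ν j L')
      (g := fun j => q ^ max ((L ⊔ L') j) 0 * ν j (L ⊔ L'))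
      (fun j _ => by
        rcases lt_or_ge (L' j) (L j) with h | h
        · exact (hw_lt j h).le
        · exact hw_le j L' (L ⊔ L') le_sup_right (by simp [h]))
      ⟨k, Finset.mem_univ k, hw_lt k hk⟩
    rw [hw_sum, hw_sum] at hsum
    exact lt_irrefl _ hsum
  refine ⟨hLL', (hLL' i).lt_of_ne fun h => ?_⟩
  have hi := mul_le_mul_of_nonneg_left (hw_le i L L' hLL' h.symm) hα.1.le
  rw [← hL, ← hL', h] at hi
  exact (hp'_lt_i _).not_ge hi
end

section
/- (Level preservation of one rejection step, Appendix A) Let m ≥ 2, let g = (g_{jl})_{j,l=1,…,m} be a transition matrix with g_{jl} ≥ 0, g_{jj} = 0 and ∑_{l=1}^m g_{jl} = 1 for every j, and let a_1,…,a_m ≥ 0 be local levels with ∑_{l=1}^m a_l = α. Fix an index i and assume g_{ji} · g_{ij} < 1 for all j ≠ i. Define updated levels a^new_l = a_l + a_i · g_{il} for l ≠ i, and updated transition weights g^new_{jl} = (g_{jl} + g_{ji} · g_{il}) / (1 − g_{ji} · g_{ij}) for j, l ≠ i with j ≠ l, and g^new_{jj} = 0. Then a^new_l ≥ 0 for all l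 ≠ i, ∑_{l ≠ i} a^new_l = α, and for every j ≠ i: g^new_{jl} ≥ 0 and ∑_{l ≠ i, l ≠ j} g^new_{jl} = 1. -/
open Filter Topology

/-- Level preservation of one rejection step of the graphical procedure (Appendix A):
rejecting `H_i` and updating the local levels and transition weights by equation (2.3)
preserves nonnegativity, the total level `α`, and the row sums (equal to one) of the
remaining graph, provided no two-node loop `g j i * g i j = 1` occurs. -/
theorem stmt17 (m : ℕ) (hm : 2 ≤ m) (α : ℝ)
    (g : Fin m → Fin m → ℝ) (a : Fin m → ℝ)
    (hg_nonneg : ∀ j l, 0 ≤ g j l)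
    (hg_diag : ∀ j, g j j = 0)
    (hg_row : ∀ j, ∑ l, g j l = 1)
    (ha_nonneg : ∀ l, 0 ≤ a l)
    (ha_sum : ∑ l, a l = α)
    (i : Fin m)
    (hloop : ∀ j, j ≠ i → g j i * g i j < 1) :
    (∀ l, l ≠ i → 0 ≤ a l + a i * g i l)
    ∧ (∑ l ∈ Finset.univ.erase i, (a l + a i * g i l)) = α
    ∧ ∀ j, j ≠ i →
        (∀ l, l ≠ i → l ≠ j →
          0 ≤ (g j l + g j i * g i l) / (1 - g j i * g i j))
        ∧ (∑ l ∈ (Finset.univ.erase i).erase j,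
            (g j l + g j i * g i l) / (1 - g j i * g i j)) = 1 := by
  have sum_erase (f : Fin m → ℝ) : ∑ l ∈ Finset.univ.erase i, f l = ∑ l, f l - f i :=
    Finset.sum_erase_eq_sub (Finset.mem_univ i)
  refine ⟨fun l _ => add_nonneg (ha_nonneg l) (mul_nonneg (ha_nonneg i) (hg_nonneg i l)), ?_,
    fun j hj => ⟨fun l _ _ => ?_, ?_⟩⟩
  · rw [sum_erase, Finset.sum_add_distrib, ← Finset.mul_sum, hg_row, hg_diag, ha_sum]
    ring
  · exact div_nonneg (add_nonneg (hg_nonneg j l) (mul_nonneg (hg_nonneg j i) (hg_nonneg i l)))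
      (sub_pos.2 (hloop j hj)).le
  · rw [← Finset.sum_div, div_eq_one_iff_eq (sub_pos.2 (hloop j hj)).ne',
      Finset.sum_erase_eq_sub (Finset.mem_erase.2 ⟨hj, Finset.mem_univ j⟩), sum_erase,
      Finset.sum_add_distrib, ← Finset.mul_sum, hg_row, hg_row, hg_diag, hg_diag]
    ring
end

section
/- (Finite termination of Algorithm 1 for the fallback procedure, Appendix C) Fix q ∈ (0,1), α ∈ (0,1), an integer m ≥ 1 and strictly positive reals c_1,…,c_m with ∑_{l=1}^m c_l = 1. Define ν_j(μ) = ∑_{l=1}^{j−1} c_l · ∏_{s=l}^{j−1} (1 − q^{max(μ_s,0)}) + c_j, and define ω_j(t) = q^{max(t,0)} for j < m and ω_m(t) = 1. For each j let p_j : ℝ → (0,1) be a continuous, strictly increasing function with p_j(t) → 0 as t → −∞ and p_j(t) → 1 as t → +∞, and given μ^(0) ∈ ℝ^m, define iterates by letting μ_j^(k+1) be the unique real solution of p_j(μ_j^(k+1)) / ω_j(μ_j^(k+1)) = ν_j(μ^(k)) · α. Then the iterates stabilize coordinate by coordinate: μ_j^(k) = μ_j^(j) for all k ≥ j and all j = 1,…,m;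 in particular μ^(k) = μ^(m) for all k ≥ m, so the algorithm terminates after m steps. -/
open Filter Topology

/-- The weight functions of the fallback procedure, equation (C.1):
`ν j μ = ∑_{l < j} c l * ∏_{s = l}^{j-1} (1 - q ^ max (μ s) 0) + c j`
(indices `0`-based over `Fin m`). -/
noncomputable def nuFB (q : ℝ) {m : ℕ} (c : Fin m → ℝ) (j : Fin m)
    (μ : Fin m → ℝ) : ℝ :=
  (∑ l ∈ Finset.Iio j, c l * ∏ s ∈ Finset.Ico l j, (1 - q ^ max (μ s) 0)) + c j

/-- The weight `ω j t`, equal to `q ^ max t 0` for all but the last hypothesis, and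
equal to `1` for the last hypothesis (Remark 2.3, non-complete graphs). -/
noncomputable def omegaFB (q : ℝ) {m : ℕ} (j : Fin m) (t : ℝ) : ℝ :=
  if j.val + 1 < m then q ^ max t 0 else 1

theorem nuFB_congr (q : ℝ) {m : ℕ} (c : Fin m → ℝ) (j : Fin m) {μ μ' : Fin m → ℝ}
    (h : ∀ s < j, μ s = μ' s) : nuFB q c j μ = nuFB q c j μ' := by
  unfold nuFB
  congr 1
  refine Finset.sum_congr rfl fun l _ => ?_
  congr 1
  refine Finset.prod_congr rfl fun s hs => ?_
  rw [h s (Finset.mem_Ico.mp hs).2]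

theorem omegaFB_pos {q : ℝ} (hq : 0 < q) {m : ℕ} (j : Fin m) (t : ℝ) :
    0 < omegaFB q j t := by
  unfold omegaFB
  split_ifs
  · exact Real.rpow_pos_of_pos hq _
  · exact one_pos

theorem omegaFB_antitone {q : ℝ} (hq : 0 < q) (hq1 : q ≤ 1) {m : ℕ} (j : Fin m) :
    Antitone (omegaFB q j) := by
  intro s t hst
  unfold omegaFB
  split_ifs
  · exact Real.rpow_le_rpow_of_exponent_ge hq hq1 (max_le_max_right 0 hst)
  · exact le_rfl

theorem strictMono_div_omegaFB {q : ℝ} (hq : 0 < q) (hq1 : q ≤ 1) {m : ℕ} (j : Fin m)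
    {f : ℝ → ℝ} (hf : StrictMono f) (hf0 : ∀ t, 0 ≤ f t) :
    StrictMono fun t => f t / omegaFB q j t := fun _ t hst =>
  div_lt_div₀ (hf hst) (omegaFB_antitone hq hq1 j hst.le) (hf0 t) (omegaFB_pos hq j t)

/-- Finite termination of Algorithm 1 for the fallback procedure (Appendix C): the
iterates stabilize coordinate by coordinate, the `j`-th (0-based) coordinate being
constant from iterate `j + 1` on; in particular `μ k = μ m` for all `k ≥ m`, so the
algorithm terminates after `m` steps. -/
theorem stmt19 (q α : ℝ) (hq : q ∈ Set.Ioo (0 : ℝ) 1) (hα : α ∈ Set.Ioo (0 : ℝ) 1)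
    (m : ℕ) (hm : 1 ≤ m)
    (c : Fin m → ℝ) (hc : ∀ l, 0 < c l) (hcsum : ∑ l, c l = 1)
    (p : Fin m → ℝ → ℝ)
    (hp_cont : ∀ j, Continuous (p j))
    (hp_mono : ∀ j, StrictMono (p j))
    (hp_range : ∀ j t, p j t ∈ Set.Ioo (0 : ℝ) 1)
    (hp_bot : ∀ j, Tendsto (p j) atBot (nhds 0))
    (hp_top : ∀ j, Tendsto (p j) atTop (nhds 1))
    (μ : ℕ → Fin m → ℝ)
    (hstep : ∀ k j, p j (μ (k + 1) j) / omegaFB q j (μ (k + 1) j)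
      = nuFB q c j (μ k) * α) :
    (∀ j : Fin m, ∀ k, j.val + 1 ≤ k → μ k j = μ (j.val + 1) j)
    ∧ ∀ k, m ≤ k → μ k = μ m := by
  have key : ∀ j : Fin m, ∀ k, j.val + 1 ≤ k → μ k j = μ (j.val + 1) j := by
    intro j
    induction j using WellFoundedLT.induction with
    | ind j ih =>
      rintro (_ | k) hk
      · omega
      · refine (strictMono_div_omegaFB hq.1 hq.2.le j (hp_mono j)
          fun t => (hp_range j t).1.le).injective ?_
        simp only [hstep]
        rw [nuFB_congr q c j fun s hs => ?_]
        have hsj : s.val < j.val := hs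
        rw [ih s hs k (by omega), ih s hs j.val (by omega)]
  refine ⟨key, fun k hk => funext fun j => ?_⟩
  rw [key j k (by omega), key j m (by omega)]
end
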